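/- arXiv:math/0512541 — 2 statements merged into one kernel-verified Lean document; each statement's English description precedes it below -/
import Mathlib

section
/- Fix σ > 0 and a ∈ ℝ with 1 < a − σ and a + σ < 4, and consider the random logistic map f(x; ω) = (a + σω) x (1 − x) on [0, 1], where ω is drawn from the uniform probability distribution ν on [−1, 1] (under the standing assumption each map sends [0, 1] into itself and the origin is a repelling fixed point). Then the random logistic map has exactly one stationary probability measure concentrated on (0, 1): there is a unique Borel probability measure μ on [0, 1] with μ((0, 1)) = 1 such that μ(A) = ∫_{[0,1]} P(x, A) dμ(x) for every Borel set A ⊆ [0, 1], where P(x, A) = ν{ω ∈ [−1, 1] : f(x; ω) ∈ A}. -/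
open MeasureTheory

/-- The uniform probability measure on the interval `[−1, 1]`. -/
noncomputable def uniformNoise : Measure ℝ :=
  (2 : ENNReal)⁻¹ • (volume.restrict (Set.Icc (-1 : ℝ) 1))

/-- The random logistic map `f(x; ω) = (a + σω) x (1 − x)`. -/
def randomLogisticMap (σ a x ω : ℝ) : ℝ := (a + σ * ω) * x * (1 - x)

section Auxiliary

open Set Filter Topology ProbabilityTheory
open scoped ENNReal NNReal BoundedContinuousFunction

/-- The cross ratio `(t - s)(q - p) / ((s - p)(q - t))` of four real numbers. -/
noncomputable def realCrossRatio (p s t q : ℝ) : ℝ :=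
  (t - s) * (q - p) / ((s - p) * (q - t))

lemma realCrossRatio_reverse (p s t q : ℝ) :
    realCrossRatio q t s p = realCrossRatio p s t q := by
  unfold realCrossRatio
  congr 1 <;> ring

lemma realCrossRatio_pos {p s t q : ℝ} (hps : p < s) (hst : s < t) (htq : t < q) :
    0 < realCrossRatio p s t q := by
  have h₁ : 0 < s - p := by linarith
  have h₂ : 0 < t - s := by linarith
  have h₃ : 0 < q - t := by linarith
  have h₄ : 0 < q - p := by linarith
  unfold realCrossRatio
  positivity

lemma realCrossRatio_mono_left {p p' s t q : ℝ} (hp : p ≤ p') (hps : p' < s) (hst : s ≤ t)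
    (htq : t < q) : realCrossRatio p s t q ≤ realCrossRatio p' s t q := by
  unfold realCrossRatio
  have h₁ : 0 < s - p' := by linarith
  have h₂ : 0 < s - p := by linarith
  have h₃ : 0 < q - t := by linarith
  rw [div_le_div_iff₀ (by positivity) (by positivity)]
  have : 0 ≤ (t - s) * (q - t) * ((p' - p) * (q - s)) := by
    have : 0 ≤ t - s := by linarith
    have : 0 ≤ p' - p := by linarith
    have : 0 ≤ q - s := by linarith
    positivity
  linarith

lemma realCrossRatio_mono_right {p s t q q' : ℝ} (hq : q' ≤ q) (hps : p < s) (hst : s ≤ t)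
    (htq : t < q') : realCrossRatio p s t q ≤ realCrossRatio p s t q' := by
  unfold realCrossRatio
  have h₁ : 0 < q' - t := by linarith
  have h₂ : 0 < s - p := by linarith
  have h₃ : 0 < q - t := by linarith
  rw [div_le_div_iff₀ (by positivity) (by positivity)]
  have : 0 ≤ (t - s) * (s - p) * ((q - q') * (t - p)) := by
    have : 0 ≤ t - s := by linarith
    have : 0 ≤ q - q' := by linarith
    have : 0 ≤ t - p := by linarith
    positivity
  linarith

/-- A logistic map expands the cross ratio of four points on one side of the critical point. -/
lemma realCrossRatio_lt_logistic {l p s t q : ℝ} (hl : l ≠ 0) (hps : p < s) (hst : s < t)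
    (htq : t < q) (h : 0 < (1 - s - p) * (1 - q - t)) :
    realCrossRatio p s t q <
      realCrossRatio (l * (p * (1 - p))) (l * (s * (1 - s))) (l * (t * (1 - t)))
        (l * (q * (1 - q))) := by
  have h₁ : 0 < s - p := by linarith
  have h₂ : 0 < t - s := by linarith
  have h₃ : 0 < q - t := by linarith
  have h₄ : 0 < q - p := by linarith
  have key : realCrossRatio (l * (p * (1 - p))) (l * (s * (1 - s))) (l * (t * (1 - t)))
      (l * (q * (1 - q))) =
      realCrossRatio p s t q * (((1 - s - t) * (1 - p - q)) / ((1 - s - p) * (1 - q - t))) := by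
    unfold realCrossRatio
    rw [div_mul_div_comm]
    have e₁ : (l * (t * (1 - t)) - l * (s * (1 - s))) * (l * (q * (1 - q)) - l * (p * (1 - p))) =
      l ^ 2 * ((t - s) * (q - p) * ((1 - s - t) * (1 - p - q))) := by ring
    have e₂ : (l * (s * (1 - s)) - l * (p * (1 - p))) * (l * (q * (1 - q)) - l * (t * (1 - t))) =
      l ^ 2 * ((s - p) * (q - t) * ((1 - s - p) * (1 - q - t))) := by ring
    rw [e₁, e₂, mul_div_mul_left _ _ (pow_ne_zero 2 hl)]
  rw [key]
  refine lt_mul_of_one_lt_right (realCrossRatio_pos hps hst htq) ?_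
  rw [one_lt_div h]
  nlinarith [mul_pos (show 0 < t - p by linarith) (show 0 < q - s by linarith)]

/-- If a closed invariant set of a logistic map contains the endpoints and the critical point,
then a closed invariant set disjoint from it contains no nontrivial interval. -/
lemma not_Icc_subset_of_disjoint_invariant {l : ℝ} (hl : 0 < l)
    {M N : Set ℝ} (hM : IsClosed M) (hN : IsClosed N) (hM1 : M ⊆ Icc 0 1) (hN1 : N ⊆ Icc 0 1)
    (hMf : ∀ x ∈ M, l * (x * (1 - x)) ∈ M) (hNf : ∀ x ∈ N, l * (x * (1 - x)) ∈ N)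
    (h0 : (0 : ℝ) ∈ N) (hhalf : (1 / 2 : ℝ) ∈ N) (h1 : (1 : ℝ) ∈ N) (hMN : Disjoint M N)
    {u v : ℝ} (huv : u < v) : ¬ Icc u v ⊆ M := by
  intro hI
  have hne : ∀ x ∈ M, ∀ y ∈ N, x ≠ y := fun x hx y hy h => disjoint_left.1 hMN hx (h ▸ hy)
  let K : Set (ℝ × ℝ × ℝ × ℝ) := {z | (z.1 ∈ N ∧ z.2.1 ∈ M ∧ z.2.2.1 ∈ M ∧ z.2.2.2 ∈ N) ∧
    z.1 ≤ z.2.1 ∧ z.2.1 ≤ z.2.2.1 ∧ z.2.2.1 ≤ z.2.2.2 ∧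
    ∀ θ ∈ Icc (0 : ℝ) 1, z.2.1 + θ * (z.2.2.1 - z.2.1) ∈ M}
  have memK : ∀ p s t q : ℝ, p ∈ N → q ∈ N → p ≤ s → s ≤ t → t ≤ q → Icc s t ⊆ M →
      (p, s, t, q) ∈ K := by
    intro p s t q hp hq hps hst htq hs
    refine ⟨⟨hp, hs ⟨le_rfl, hst⟩, hs ⟨hst, le_rfl⟩, hq⟩, hps, hst, htq, fun θ hθ => hs ⟨?_, ?_⟩⟩
    · have := mul_nonneg hθ.1 (sub_nonneg.2 hst)
      simp only; linarith
    · have := mul_le_mul_of_nonneg_right hθ.2 (sub_nonneg.2 hst)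
      simp only; linarith
  have hIcc : ∀ p s t q : ℝ, (p, s, t, q) ∈ K → Icc s t ⊆ M := by
    rintro p s t q ⟨⟨-, hs, -, -⟩, -, hst, -, h⟩ x hx
    simp only at hst h hs
    rcases hst.eq_or_lt with rfl | hlt
    · rwa [le_antisymm hx.2 hx.1]
    · have h' := h ((x - s) / (t - s)) ⟨div_nonneg (by linarith [hx.1]) (by linarith),
        (div_le_one (by linarith)).2 (by linarith [hx.2])⟩
      rwa [div_mul_cancel₀ _ (by linarith), add_sub_cancel] at h'
  have hKc : IsCompact K := by
    have hMc : IsCompact M := isCompact_Icc.of_isClosed_subset hM hM1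
    have hNc : IsCompact N := isCompact_Icc.of_isClosed_subset hN hN1
    refine (hNc.prod (hMc.prod (hMc.prod hNc))).of_isClosed_subset ?_
      (fun z hz => ⟨hz.1.1, hz.1.2.1, hz.1.2.2.1, hz.1.2.2.2⟩)
    refine IsClosed.inter ?_ (IsClosed.inter ?_ (IsClosed.inter ?_ (IsClosed.inter ?_ ?_)))
    · exact (hN.preimage (by fun_prop)).inter ((hM.preimage (by fun_prop)).inter
        ((hM.preimage (by fun_prop)).inter (hN.preimage (by fun_prop))))
    · exact isClosed_le continuous_fst continuous_snd.fst
    · exact isClosed_le continuous_snd.fst continuous_snd.snd.fst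
    · exact isClosed_le continuous_snd.snd.fst continuous_snd.snd.snd
    · have : {z : ℝ × ℝ × ℝ × ℝ | ∀ θ ∈ Icc (0 : ℝ) 1, z.2.1 + θ * (z.2.2.1 - z.2.1) ∈ M} =
          ⋂ θ ∈ Icc (0 : ℝ) 1,
            (fun z : ℝ × ℝ × ℝ × ℝ => z.2.1 + θ * (z.2.2.1 - z.2.1)) ⁻¹' M := by
        ext z; simp
      change IsClosed {z : ℝ × ℝ × ℝ × ℝ | ∀ θ ∈ Icc (0 : ℝ) 1,
        z.2.1 + θ * (z.2.2.1 - z.2.1) ∈ M}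
      rw [this]
      exact isClosed_biInter fun θ _ => hM.preimage (by fun_prop)
  have hstrict : ∀ p s t q : ℝ, (p, s, t, q) ∈ K → p < s ∧ t < q := by
    rintro p s t q ⟨⟨hp, hs, ht, hq⟩, hps, -, htq, -⟩
    exact ⟨lt_of_le_of_ne hps (hne _ hs _ hp).symm, lt_of_le_of_ne htq (hne _ ht _ hq)⟩
  have hcont : ContinuousOn (fun z : ℝ × ℝ × ℝ × ℝ => realCrossRatio z.1 z.2.1 z.2.2.1 z.2.2.2)
      K := by
    unfold realCrossRatio
    refine ContinuousOn.div (by fun_prop) (by fun_prop) ?_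
    rintro ⟨p, s, t, q⟩ hz
    obtain ⟨h₁, h₂⟩ := hstrict p s t q hz
    exact mul_ne_zero (by simp only; linarith) (by simp only; linarith)
  have huM : u ∈ M := hI ⟨le_rfl, huv.le⟩
  have hvM : v ∈ M := hI ⟨huv.le, le_rfl⟩
  have hz₀ : ((0 : ℝ), u, v, (1 : ℝ)) ∈ K :=
    memK _ _ _ _ h0 h1 (hM1 huM).1 huv.le (hM1 hvM).2 hI
  obtain ⟨⟨p, s, t, q⟩, hz, hmax⟩ := hKc.exists_isMaxOn ⟨_, hz₀⟩ hcont
  have hmax' : ∀ p' s' t' q' : ℝ, (p', s', t', q') ∈ K →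
      realCrossRatio p' s' t' q' ≤ realCrossRatio p s t q := fun p' s' t' q' h => hmax h
  have hIst := hIcc _ _ _ _ hz
  obtain ⟨hps, htq⟩ := hstrict _ _ _ _ hz
  obtain ⟨⟨hp, hs, ht, hq⟩, -, hst, -, -⟩ := id hz
  simp only at hp hs ht hq hst
  have hpos : 0 < realCrossRatio p s t q :=
    (realCrossRatio_pos (hstrict _ _ _ _ hz₀).1 huv (hstrict _ _ _ _ hz₀).2).trans_le
      (hmax' _ _ _ _ hz₀)
  have hlt : s < t := by
    refine lt_of_le_of_ne hst fun h => ?_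
    rw [h] at hpos
    simp [realCrossRatio] at hpos
  have hmono : ∀ x y : ℝ, x ≤ y → x + y ≤ 1 → l * (x * (1 - x)) ≤ l * (y * (1 - y)) := by
    intro x y hxy h
    refine mul_le_mul_of_nonneg_left ?_ hl.le
    nlinarith [mul_nonneg (sub_nonneg.2 hxy) (sub_nonneg.2 h)]
  have hanti : ∀ x y : ℝ, x ≤ y → 1 ≤ x + y → l * (y * (1 - y)) ≤ l * (x * (1 - x)) := by
    intro x y hxy h
    refine mul_le_mul_of_nonneg_left ?_ hl.le
    nlinarith [mul_nonneg (sub_nonneg.2 hxy) (sub_nonneg.2 h)]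
  have hfc : Continuous fun x : ℝ => l * (x * (1 - x)) := by fun_prop
  rcases lt_or_ge (1 / 2) s with hside | hside
  · have hp'N : max p (1 / 2) ∈ N := by rcases max_choice p (1 / 2) with h | h <;> rwa [h]
    have hp' : max p (1 / 2) < s := max_lt hps hside
    have hge : 1 / 2 ≤ max p (1 / 2) := le_max_right _ _
    have hle := realCrossRatio_mono_left (le_max_left p (1 / 2)) hp' hlt.le htq
    generalize max p (1 / 2) = p' at *
    have hK' := memK _ _ _ _ (hNf _ hq) (hNf _ hp'N) (hanti _ _ htq.le (by linarith))
      (hanti _ _ hlt.le (by linarith)) (hanti _ _ hp'.le (by linarith))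
      (fun y hy => by
        obtain ⟨x, hx, rfl⟩ := intermediate_value_Icc' hlt.le hfc.continuousOn hy
        exact hMf x (hIst hx))
    have h₁ := hmax' _ _ _ _ hK'
    rw [realCrossRatio_reverse] at h₁
    have h₂ := realCrossRatio_lt_logistic hl.ne' hp' hlt htq
      (mul_pos_of_neg_of_neg (by linarith) (by linarith))
    linarith
  · have ht2 : t < 1 / 2 := by
      by_contra h
      exact hne _ (hIst ⟨hside, not_lt.1 h⟩) _ hhalf rfl
    have hq'N : min q (1 / 2) ∈ N := by rcases min_choice q (1 / 2) with h | h <;> rwa [h]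
    have hq' : t < min q (1 / 2) := lt_min htq ht2
    have hle' : min q (1 / 2) ≤ 1 / 2 := min_le_right _ _
    have hle := realCrossRatio_mono_right (min_le_left q (1 / 2)) hps hlt.le hq'
    generalize min q (1 / 2) = q' at *
    have hK' := memK _ _ _ _ (hNf _ hp) (hNf _ hq'N) (hmono _ _ hps.le (by linarith))
      (hmono _ _ hlt.le (by linarith)) (hmono _ _ hq'.le (by linarith))
      (fun y hy => by
        obtain ⟨x, hx, rfl⟩ := intermediate_value_Icc hlt.le hfc.continuousOn hy
        exact hMf x (hIst hx))
    have h₁ := hmax' _ _ _ _ hK'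
    have h₂ := realCrossRatio_lt_logistic hl.ne' hps hlt hq'
      (mul_pos (by linarith) (by linarith))
    linarith

lemma bind_mono_of_le {α β : Type*} [MeasurableSpace α] [MeasurableSpace β] (κ : Kernel α β)
    {μ ν : Measure α} (h : μ ≤ ν) : μ.bind κ ≤ ν.bind κ := by
  refine Measure.le_iff.2 fun s hs => ?_
  rw [Measure.bind_apply hs κ.aemeasurable, Measure.bind_apply hs κ.aemeasurable]
  exact lintegral_mono' h le_rfl

lemma bind_univ_of_isMarkovKernel {α β : Type*} [MeasurableSpace α] [MeasurableSpace β]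
    (κ : Kernel α β) [IsMarkovKernel κ] (μ : Measure α) : μ.bind κ univ = μ univ := by
  rw [Measure.bind_apply .univ κ.aemeasurable]
  simp

/-- Subtracting an invariant finite measure from a larger invariant measure preserves
invariance. -/
lemma ProbabilityTheory.Kernel.Invariant.sub {α : Type*} [MeasurableSpace α] {κ : Kernel α α}
    [IsMarkovKernel κ] {μ ν : Measure α} [IsFiniteMeasure ν] (hμ : κ.Invariant μ)
    (hν : κ.Invariant ν) (h : ν ≤ μ) : κ.Invariant (μ - ν) := by
  have h₁ : (μ - ν).bind κ + ν = μ := by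
    nth_rw 2 [← hν.def]
    rw [← Measure.comp_add, Measure.sub_add_cancel_of_le h, hμ.def]
  calc (μ - ν).bind κ = (μ - ν).bind κ + ν - ν := Measure.add_sub_cancel.symm
    _ = μ - ν := by rw [h₁]

/-- The infimum of two invariant finite measures of a Markov kernel is invariant. -/
lemma ProbabilityTheory.Kernel.Invariant.inf {α : Type*} [MeasurableSpace α] {κ : Kernel α α}
    [IsMarkovKernel κ] {μ ν : Measure α} [IsFiniteMeasure μ] (hμ : κ.Invariant μ)
    (hν : κ.Invariant ν) : κ.Invariant (μ ⊓ ν) := by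
  have : IsFiniteMeasure (μ ⊓ ν) := isFiniteMeasure_of_le μ inf_le_left
  refine Measure.eq_of_le_of_measure_univ_eq (le_inf ?_ ?_) (bind_univ_of_isMarkovKernel κ _)
  · exact (bind_mono_of_le κ inf_le_left).trans_eq hμ
  · exact (bind_mono_of_le κ inf_le_right).trans_eq hν

/-- If any two nonzero invariant measures dominated by `μ` and `ν` have a nonzero common lower
bound, then the invariant probability measures `μ` and `ν` coincide. -/
lemma ProbabilityTheory.Kernel.Invariant.eq_of_exists_common_lower_bound {α : Type*}
    [MeasurableSpace α] {κ : Kernel α α} [IsMarkovKernel κ] {μ ν : Measure α}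
    [IsProbabilityMeasure μ] [IsProbabilityMeasure ν] (hμ : κ.Invariant μ) (hν : κ.Invariant ν)
    (h : ∀ μ' ν' : Measure α, μ' ≤ μ → ν' ≤ ν → κ.Invariant μ' → κ.Invariant ν' → μ' ≠ 0 →
      ν' ≠ 0 → ∃ τ : Measure α, τ ≠ 0 ∧ τ ≤ μ' ∧ τ ≤ ν') : μ = ν := by
  have hinf := hμ.inf hν
  have hfin : IsFiniteMeasure (μ ⊓ ν) := isFiniteMeasure_of_le μ inf_le_left
  have hl : μ ⊓ ν ≤ μ := inf_le_left
  have hr : μ ⊓ ν ≤ ν := inf_le_right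
  by_cases hu : (μ ⊓ ν) univ = 1
  · exact (Measure.eq_of_le_of_measure_univ_eq hl (by simpa using hu)).symm.trans
      (Measure.eq_of_le_of_measure_univ_eq hr (by simpa using hu))
  exfalso
  have hne : ∀ ρ : Measure α, ρ univ = 1 → μ ⊓ ν ≤ ρ → ρ - (μ ⊓ ν) ≠ 0 := by
    intro ρ hρ hle h0
    have := Measure.sub_add_cancel_of_le hle
    rw [h0, zero_add] at this
    exact hu (this ▸ hρ)
  obtain ⟨τ, hτ, hτμ, hτν⟩ := h _ _ Measure.sub_le Measure.sub_le (hμ.sub hinf hl)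
    (hν.sub hinf hr) (hne μ measure_univ hl) (hne ν measure_univ hr)
  have hle : τ + μ ⊓ ν ≤ μ ⊓ ν := by
    refine le_inf ?_ ?_
    · exact (add_le_add_left hτμ _).trans_eq (Measure.sub_add_cancel_of_le hl)
    · exact (add_le_add_left hτν _).trans_eq (Measure.sub_add_cancel_of_le hr)
  have hle' : (μ ⊓ ν) + τ ≤ (μ ⊓ ν) + 0 := by rwa [add_zero, add_comm]
  exact hτ (le_antisymm (Measure.le_of_add_le_add_left hle') (Measure.zero_le _))

/-- **Krylov–Bogoliubov theorem** for a Feller kernel preserving a nonempty compact set. -/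
lemma ProbabilityTheory.Kernel.exists_invariant_of_isCompact {E : Type*} [TopologicalSpace E]
    [T2Space E] [MeasurableSpace E] [BorelSpace E] [HasOuterApproxClosed E] (κ : Kernel E E)
    [IsMarkovKernel κ] (hκ : ∀ φ : E →ᵇ ℝ≥0, Continuous fun x => ∫⁻ y, φ y ∂κ x)
    {K : Set E} (hK : IsCompact K) (hne : K.Nonempty) (hinv : ∀ x ∈ K, κ x Kᶜ = 0) :
    ∃ μ : Measure E, IsProbabilityMeasure μ ∧ μ Kᶜ = 0 ∧ κ.Invariant μ := by
  obtain ⟨x₀, hx₀⟩ := hne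
  have hKm : MeasurableSet Kᶜ := hK.measurableSet.compl
  let m : ℕ → Measure E := fun n => (fun ρ : Measure E => ρ.bind κ)^[n] (Measure.dirac x₀)
  have hm_succ : ∀ n, m (n + 1) = (m n).bind κ := fun n => Function.iterate_succ_apply' _ _ _
  have hm_univ : ∀ n, m n univ = 1 := by
    intro n
    induction n with
    | zero => simp [m]
    | succ n ih => rw [hm_succ, bind_univ_of_isMarkovKernel, ih]
  have hmK : ∀ n, m n Kᶜ = 0 := by
    intro n
    induction n with
    | zero => simp [m, Measure.dirac_apply' _ hKm, hx₀]
    | succ n ih =>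
      rw [hm_succ, Measure.bind_apply hKm κ.aemeasurable]
      refine lintegral_eq_zero_of_ae_eq_zero ?_
      filter_upwards [compl_mem_ae_iff.2 ih] with x hx
      exact hinv x (not_not.1 hx)
  let c : ℕ → ℝ≥0∞ := fun n => ((n + 1 : ℕ) : ℝ≥0∞)⁻¹
  have hc : ∀ n, c n * ((n + 1 : ℕ) : ℝ≥0∞) = 1 := fun n =>
    ENNReal.inv_mul_cancel (by simp) (ENNReal.natCast_ne_top _)
  let ρ : ℕ → Measure E := fun n => c n • ∑ k ∈ Finset.range (n + 1), m k
  have hρ_univ : ∀ n, ρ n univ = 1 := by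
    intro n
    simp only [ρ, Measure.smul_apply, Measure.finsetSum_apply, hm_univ, smul_eq_mul]
    simpa using hc n
  have hρK : ∀ n, ρ n Kᶜ = 0 := by
    intro n
    simp [ρ, Measure.smul_apply, Measure.finsetSum_apply, hmK]
  have hρ_bind : ∀ n, (ρ n).bind κ + c n • m 0 = ρ n + c n • m (n + 1) := by
    intro n
    have : (∑ k ∈ Finset.range (n + 1), m k).bind κ = ∑ k ∈ Finset.range (n + 1), m (k + 1) := by
      generalize n + 1 = j
      induction j with
      | zero => simp
      | succ j ih => rw [Finset.sum_range_succ, Measure.comp_add, ih, Finset.sum_range_succ, hm_succ]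
    simp only [ρ]
    rw [Measure.bind_smul, this, ← smul_add, ← smul_add, ← Finset.sum_range_succ',
      ← Finset.sum_range_succ]
  let R : ℕ → FiniteMeasure E := fun n => ⟨ρ n, ⟨by rw [hρ_univ]; exact ENNReal.one_lt_top⟩⟩
  have hcpt := isCompact_setOfPred_finiteMeasure_le_of_isCompact (E := E) 1 hK
  obtain ⟨μ, hμmem, hμ⟩ := hcpt.ultrafilter_le_nhds' ((hyperfilter ℕ).map R) (by
    rw [Ultrafilter.mem_map]
    refine univ_mem' fun n => ⟨?_, ?_⟩
    · rw [← ENNReal.coe_le_coe, FiniteMeasure.ennreal_mass]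
      exact (hρ_univ n).le
    · rw [FiniteMeasure.null_iff_toMeasure_null]
      exact hρK n)
  have hlim : Tendsto R (hyperfilter ℕ) (𝓝 μ) := hμ
  rw [FiniteMeasure.tendsto_iff_forall_lintegral_tendsto] at hlim
  have hc0 : Tendsto c (hyperfilter ℕ) (𝓝 0) := by
    have : Tendsto c atTop (𝓝 0) :=
      ENNReal.tendsto_inv_nat_nhds_zero.comp (tendsto_add_atTop_nat 1)
    exact this.mono_left (by rw [← Nat.cofinite_eq_atTop]; exact hyperfilter_le_cofinite)
  refine ⟨μ, ⟨?_⟩, (FiniteMeasure.null_iff_toMeasure_null _ _).1 hμmem.2, ?_⟩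
  · have h1 := hlim 1
    refine tendsto_nhds_unique (by simpa using h1) (tendsto_const_nhds.congr fun n => ?_)
    exact (hρ_univ n).symm
  refine (ext_of_forall_lintegral_eq_of_IsFiniteMeasure fun φ => ?_).symm
  have hφm : Measurable fun x => (φ x : ℝ≥0∞) := by fun_prop
  obtain ⟨C, hφC⟩ : ∃ C : ℝ≥0, ∀ x, (φ x : ℝ≥0∞) ≤ C := ⟨nndist φ 0, fun x =>
    ENNReal.coe_le_coe.2 (BoundedContinuousFunction.NNReal.upper_bound φ x)⟩
  have hbd : ∀ x, ∫⁻ y, φ y ∂κ x ≤ C := fun x =>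
    (lintegral_mono hφC).trans (by simp)
  have hfin : ∀ x, ∫⁻ y, φ y ∂κ x ≠ ∞ := fun x => ((hbd x).trans_lt ENNReal.coe_lt_top).ne
  let ψ : E →ᵇ ℝ≥0 := BoundedContinuousFunction.mkOfBound
    ⟨fun x => (∫⁻ y, φ y ∂κ x).toNNReal,
      continuous_iff_continuousAt.2 fun x =>
        (ENNReal.tendsto_toNNReal (hfin x)).comp (hκ φ).continuousAt⟩ C (by
      intro x y
      have hb : ∀ z, (∫⁻ y, φ y ∂κ z).toNNReal ≤ C := fun z => by
        have := ENNReal.toNNReal_mono ENNReal.coe_ne_top (hbd z)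
        simpa using this
      have hx := hb x
      have hy := hb y
      rw [NNReal.dist_eq, abs_sub_le_iff]
      have hx' : ((∫⁻ y, φ y ∂κ x).toNNReal : ℝ) ≤ C := by exact_mod_cast hx
      have hy' : ((∫⁻ w, φ w ∂κ y).toNNReal : ℝ) ≤ C := by exact_mod_cast hy
      simp only [ContinuousMap.coe_mk]
      constructor <;> linarith [NNReal.coe_nonneg (∫⁻ w, φ w ∂κ x).toNNReal,
        NNReal.coe_nonneg (∫⁻ w, φ w ∂κ y).toNNReal])
  have hψ : ∀ x, (ψ x : ℝ≥0∞) = ∫⁻ y, φ y ∂κ x := fun x => ENNReal.coe_toNNReal (hfin x)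
  have hbind : ∀ ν : Measure E, ∫⁻ x, φ x ∂ν.bind κ = ∫⁻ x, ψ x ∂ν := by
    intro ν
    rw [Measure.lintegral_bind κ.aemeasurable hφm.aemeasurable]
    simp only [hψ]
  rw [hbind]
  have hsmall : ∀ f : ℕ → ℕ, Tendsto (fun n => c n * ∫⁻ x, φ x ∂m (f n)) (hyperfilter ℕ) (𝓝 0) := by
    intro f
    have : Tendsto (fun n => c n * C) (hyperfilter ℕ) (𝓝 0) := by
      simpa using ENNReal.Tendsto.mul_const hc0 (Or.inr ENNReal.coe_ne_top)
    refine tendsto_of_tendsto_of_tendsto_of_le_of_le tendsto_const_nhds this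
      (fun n => zero_le) fun n => ?_
    refine mul_le_mul_right ((lintegral_mono hφC).trans ?_) _
    simp [hm_univ]
  have hL := (hlim ψ).add (hsmall fun _ => 0)
  have hR := (hlim φ).add (hsmall fun n => n + 1)
  rw [add_zero] at hL hR
  refine tendsto_nhds_unique hR (hL.congr fun n => ?_)
  have := congrArg (fun ν : Measure E => ∫⁻ x, φ x ∂ν) (hρ_bind n)
  simp only [lintegral_add_measure, lintegral_smul_measure, hbind, smul_eq_mul] at this
  exact this

instance : IsProbabilityMeasure uniformNoise := by
  refine ⟨?_⟩
  simp only [uniformNoise, Measure.smul_apply, Measure.restrict_apply .univ, univ_inter,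
    Real.volume_Icc, smul_eq_mul]
  norm_num
  exact ENNReal.inv_mul_cancel two_ne_zero ENNReal.ofNat_ne_top

lemma ae_uniformNoise_mem_Icc : ∀ᵐ ω ∂uniformNoise, ω ∈ Icc (-1 : ℝ) 1 :=
  Measure.smul_absolutelyContinuous (ae_restrict_mem measurableSet_Icc)

lemma uniformNoise_pos_of_mem_nhds {ω : ℝ} (hω : ω ∈ Icc (-1 : ℝ) 1) {U : Set ℝ} (hU : U ∈ 𝓝 ω) :
    0 < uniformNoise U := by
  have hne : (interior U ∩ Ioo (-1 : ℝ) 1).Nonempty := by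
    rw [← closure_Ioo (by norm_num : (-1 : ℝ) ≠ 1)] at hω
    exact mem_closure_iff.1 hω _ isOpen_interior (mem_interior_iff_mem_nhds.2 hU)
  have hpos : 0 < volume (interior U ∩ Ioo (-1 : ℝ) 1) :=
    (isOpen_interior.inter isOpen_Ioo).measure_pos _ hne
  have hle : volume (interior U ∩ Ioo (-1 : ℝ) 1) ≤ volume.restrict (Icc (-1 : ℝ) 1) U :=
    (measure_mono (inter_subset_inter interior_subset Ioo_subset_Icc_self)).trans
      (Measure.le_restrict_apply _ _)
  simp only [uniformNoise, Measure.smul_apply, smul_eq_mul]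
  exact ENNReal.mul_pos (by simp) (hpos.trans_le hle).ne'

lemma continuous_randomLogisticMap (σ a : ℝ) :
    Continuous fun p : ℝ × ℝ => randomLogisticMap σ a p.1 p.2 := by
  unfold randomLogisticMap
  fun_prop

/-- The transition kernel of the random logistic map. -/
noncomputable def randomLogisticKernel (σ a : ℝ) : Kernel ℝ ℝ where
  toFun x := uniformNoise.map (randomLogisticMap σ a x)
  measurable' := by
    refine Measure.measurable_of_measurable_coe _ fun A hA => ?_
    have hm : ∀ x, Measurable (randomLogisticMap σ a x) := fun x =>
      (continuous_randomLogisticMap σ a).measurable.comp measurable_prodMk_left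
    simp only [Measure.map_apply (hm _) hA]
    exact measurable_measure_prodMk_left ((continuous_randomLogisticMap σ a).measurable hA)

section Logistic

variable {σ a : ℝ}

lemma continuous_randomLogisticMap_right (x : ℝ) : Continuous (randomLogisticMap σ a x) :=
  (continuous_randomLogisticMap σ a).comp (Continuous.prodMk_right x)

lemma randomLogisticKernel_apply (x : ℝ) {A : Set ℝ} (hA : MeasurableSet A) :
    randomLogisticKernel σ a x A = uniformNoise {ω | randomLogisticMap σ a x ω ∈ A} :=
  Measure.map_apply (continuous_randomLogisticMap_right x).measurable hA

instance : IsMarkovKernel (randomLogisticKernel σ a) :=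
  ⟨fun x => Measure.isProbabilityMeasure_map
    (continuous_randomLogisticMap_right x).measurable.aemeasurable⟩

lemma randomLogisticKernel_invariant_iff {μ : Measure ℝ} :
    (randomLogisticKernel σ a).Invariant μ ↔ ∀ A : Set ℝ, MeasurableSet A →
      μ A = ∫⁻ x, uniformNoise {ω | randomLogisticMap σ a x ω ∈ A} ∂μ := by
  have key : ∀ A : Set ℝ, MeasurableSet A → μ.bind (randomLogisticKernel σ a) A =
      ∫⁻ x, uniformNoise {ω | randomLogisticMap σ a x ω ∈ A} ∂μ := by
    intro A hA
    rw [Measure.bind_apply hA (Kernel.aemeasurable _)]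
    simp only [randomLogisticKernel_apply _ hA]
  constructor
  · intro h A hA
    rw [← key A hA, h.def]
  · intro h
    exact Measure.ext fun A hA => (key A hA).trans (h A hA).symm

lemma continuous_lintegral_randomLogisticKernel (φ : ℝ →ᵇ ℝ≥0) :
    Continuous fun x => ∫⁻ y, φ y ∂randomLogisticKernel σ a x := by
  have hφ : Measurable fun y => (φ y : ℝ≥0∞) := by fun_prop
  have h : ∀ x, ∫⁻ y, φ y ∂randomLogisticKernel σ a x =
      ∫⁻ ω, φ (randomLogisticMap σ a x ω) ∂uniformNoise := fun x =>
    lintegral_map hφ (continuous_randomLogisticMap_right x).measurable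
  simp only [h]
  refine continuous_iff_continuousAt.2 fun x => ?_
  refine tendsto_lintegral_filter_of_dominated_convergence (fun _ => (nndist φ 0 : ℝ≥0))
    (Eventually.of_forall fun y => hφ.comp (continuous_randomLogisticMap_right y).measurable)
    (Eventually.of_forall fun y => Eventually.of_forall fun ω => ENNReal.coe_le_coe.2
      (BoundedContinuousFunction.NNReal.upper_bound φ _)) (by simp)
    (Eventually.of_forall fun ω => ?_)
  have : Continuous fun x => (φ (randomLogisticMap σ a x ω) : ℝ≥0∞) :=
    ENNReal.continuous_coe.comp (φ.continuous.comp
      ((continuous_randomLogisticMap σ a).comp (Continuous.prodMk_left ω)))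
  exact this.continuousAt

lemma randomLogisticKernel_eq_zero {x : ℝ} {A : Set ℝ} (hA : MeasurableSet A)
    (h : ∀ ω ∈ Icc (-1 : ℝ) 1, randomLogisticMap σ a x ω ∉ A) :
    randomLogisticKernel σ a x A = 0 := by
  rw [randomLogisticKernel_apply x hA]
  refine measure_mono_null (fun ω hω hI => h ω hI hω) (ae_iff.1 ae_uniformNoise_mem_Icc)

lemma exists_randomLogisticMap_eq {x w : ℝ} (hx : x ∈ Ioo (0 : ℝ) 1)
    (hw : w ∈ Icc ((a - σ) * (x * (1 - x))) ((a + σ) * (x * (1 - x)))) :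
    ∃ ω ∈ Icc (-1 : ℝ) 1, randomLogisticMap σ a x ω = w := by
  have hg : 0 < x * (1 - x) := mul_pos hx.1 (by linarith [hx.2])
  have hcont : ContinuousOn (randomLogisticMap σ a x) (Icc (-1) 1) :=
    (continuous_randomLogisticMap_right x).continuousOn
  refine intermediate_value_Icc (by norm_num) hcont ⟨?_, ?_⟩
  · refine le_trans (le_of_eq ?_) hw.1
    unfold randomLogisticMap
    ring
  · refine hw.2.trans (le_of_eq ?_)
    unfold randomLogisticMap
    ring

lemma mul_volume_le_randomLogisticKernel (hσ : 0 < σ) {x : ℝ} (hx : x ∈ Ioo (0 : ℝ) 1)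
    {A : Set ℝ} (hA : MeasurableSet A)
    (hAI : A ⊆ Icc ((a - σ) * (x * (1 - x))) ((a + σ) * (x * (1 - x)))) :
    2⁻¹ * ENNReal.ofReal (4 / σ) * volume A ≤ randomLogisticKernel σ a x A := by
  have hg : 0 < x * (1 - x) := mul_pos hx.1 (by linarith [hx.2])
  have hg4 : x * (1 - x) ≤ 1 / 4 := by nlinarith [sq_nonneg (x - 1 / 2)]
  set h := σ * (x * (1 - x)) with hh
  have hpos : 0 < h := mul_pos hσ hg
  have hset : {ω | randomLogisticMap σ a x ω ∈ A} =
      (fun ω => h * ω) ⁻¹' ((fun y => y + a * (x * (1 - x))) ⁻¹' A) := by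
    ext ω
    have : randomLogisticMap σ a x ω = h * ω + a * (x * (1 - x)) := by
      rw [hh, randomLogisticMap]
      ring
    simp [this]
  have hsub : {ω | randomLogisticMap σ a x ω ∈ A} ⊆ Icc (-1 : ℝ) 1 := by
    intro ω hω
    rw [hset] at hω
    have hω' := hAI hω
    simp only [mem_Icc] at hω'
    constructor
    · by_contra hlt
      nlinarith [mul_pos hpos (sub_pos.2 (not_le.1 hlt))]
    · by_contra hlt
      nlinarith [mul_pos hpos (sub_pos.2 (not_le.1 hlt))]
  have hmeas : MeasurableSet {ω | randomLogisticMap σ a x ω ∈ A} :=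
    (continuous_randomLogisticMap_right x).measurable hA
  rw [randomLogisticKernel_apply x hA, uniformNoise, Measure.smul_apply, smul_eq_mul,
    Measure.restrict_apply hmeas, inter_eq_left.2 hsub, hset, Real.volume_preimage_mul_left hpos.ne',
    measure_preimage_add_right, mul_assoc]
  refine mul_le_mul_right (mul_le_mul_left (ENNReal.ofReal_le_ofReal ?_) _) _
  rw [abs_of_pos (inv_pos.2 hpos), div_le_iff₀ hσ, inv_mul_eq_div, le_div_iff₀ hpos]
  nlinarith

lemma randomLogisticMap_mem_support {μ : Measure ℝ}
    (hμ : (randomLogisticKernel σ a).Invariant μ) {y ω : ℝ} (hy : y ∈ μ.support)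
    (hω : ω ∈ Icc (-1 : ℝ) 1) : randomLogisticMap σ a y ω ∈ μ.support := by
  rw [Measure.mem_support_iff_forall]
  intro U hU
  obtain ⟨V, hVU, hVo, hyV⟩ := mem_nhds_iff.1 hU
  refine lt_of_lt_of_le ?_ (measure_mono hVU)
  have hpre : (fun p : ℝ × ℝ => randomLogisticMap σ a p.1 p.2) ⁻¹' V ∈ 𝓝 (y, ω) :=
    (continuous_randomLogisticMap σ a).continuousAt.preimage_mem_nhds (hVo.mem_nhds hyV)
  obtain ⟨W, hW, S, hS, hWS⟩ := mem_nhds_prod_iff.1 hpre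
  have hWpos := (Measure.mem_support_iff_forall y).1 hy W hW
  rw [← hμ.def, Measure.bind_apply hVo.measurableSet (Kernel.aemeasurable _)]
  have hle : uniformNoise S * μ W ≤ ∫⁻ x, randomLogisticKernel σ a x V ∂μ := by
    refine le_trans ?_ (mul_meas_ge_le_lintegral
      ((randomLogisticKernel σ a).measurable_coe hVo.measurableSet) (uniformNoise S))
    refine mul_le_mul_right (measure_mono fun x hx => ?_) _
    simp only [mem_ofPred_eq]
    rw [randomLogisticKernel_apply x hVo.measurableSet]
    exact measure_mono fun ω' hω' => hWS (mk_mem_prod hx hω')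
  exact (ENNReal.mul_pos (uniformNoise_pos_of_mem_nhds hω hS).ne' hWpos.ne').trans_le hle

/-- Near the noiseless image of a point of its support, an invariant measure dominates a multiple
of Lebesgue measure, on a ball that does not depend on the invariant measure. -/
lemma exists_ball_smul_volume_le (hσ : 0 < σ) {y : ℝ}
    (hy : y ∈ Ioo (0 : ℝ) 1) :
    ∃ r > 0, ∀ μ : Measure ℝ, (randomLogisticKernel σ a).Invariant μ → y ∈ μ.support →
      ∃ c : ℝ≥0∞, c ≠ 0 ∧ c • volume.restrict (Metric.ball (a * (y * (1 - y))) r) ≤ μ := by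
  have hg : 0 < y * (1 - y) := mul_pos hy.1 (by linarith [hy.2])
  set d := σ * (y * (1 - y)) / 2 with hd
  have hd0 : 0 < d := by positivity
  have hev : ∀ᶠ x in 𝓝 y, x ∈ Ioo (0 : ℝ) 1 ∧
      (a - σ) * (x * (1 - x)) < a * (y * (1 - y)) - d ∧
      a * (y * (1 - y)) + d < (a + σ) * (x * (1 - x)) := by
    refine Eventually.and (isOpen_Ioo.mem_nhds hy) (Eventually.and ?_ ?_)
    · have : Continuous fun x : ℝ => (a - σ) * (x * (1 - x)) := by fun_prop
      exact this.continuousAt.eventually_lt continuousAt_const (by linarith)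
    · have : Continuous fun x : ℝ => (a + σ) * (x * (1 - x)) := by fun_prop
      exact continuousAt_const.eventually_lt this.continuousAt (by linarith)
  refine ⟨d, hd0, fun μ hμ hyμ => ⟨2⁻¹ * ENNReal.ofReal (4 / σ) * μ _,
    mul_ne_zero (mul_ne_zero (by simp) ?_)
      ((Measure.mem_support_iff_forall y).1 hyμ _ hev).ne', ?_⟩⟩
  · exact (ENNReal.ofReal_pos.2 (by positivity)).ne'
  refine Measure.le_iff.2 fun A hA => ?_
  set B := Metric.ball (a * (y * (1 - y))) d
  have hAB : MeasurableSet (A ∩ B) := hA.inter measurableSet_ball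
  rw [Measure.smul_apply, Measure.restrict_apply hA, smul_eq_mul]
  refine le_trans ?_ (measure_mono (inter_subset_left : A ∩ B ⊆ A))
  conv_rhs => rw [← hμ.def]
  rw [Measure.bind_apply hAB (Kernel.aemeasurable _), mul_right_comm]
  refine le_trans ?_ (mul_meas_ge_le_lintegral
      ((randomLogisticKernel σ a).measurable_coe hAB)
      (2⁻¹ * ENNReal.ofReal (4 / σ) * volume (A ∩ B)))
  refine mul_le_mul_right (measure_mono fun x hx => ?_) _
  refine mul_volume_le_randomLogisticKernel hσ hx.1 hAB fun z hz => ?_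
  have hzB : z ∈ Metric.ball (a * (y * (1 - y))) d := hz.2
  rw [Real.ball_eq_Ioo] at hzB
  exact ⟨by linarith [hzB.1, hx.2.1], by linarith [hzB.2, hx.2.2]⟩

lemma randomLogisticMap_le (hσ : 0 < σ) (h1 : 1 < a - σ) {x ω : ℝ} (hω : ω ∈ Icc (-1 : ℝ) 1) :
    randomLogisticMap σ a x ω ≤ (a + σ) / 4 := by
  have hg4 : x * (1 - x) ≤ 1 / 4 := by nlinarith [sq_nonneg (x - 1 / 2)]
  have h₁ : 0 ≤ a + σ * ω := by nlinarith [hω.1]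
  have h₂ : a + σ * ω ≤ a + σ := by nlinarith [hω.2]
  calc randomLogisticMap σ a x ω = (a + σ * ω) * (x * (1 - x)) := by
        unfold randomLogisticMap; ring
    _ ≤ (a + σ * ω) * (1 / 4) := mul_le_mul_of_nonneg_left hg4 h₁
    _ ≤ (a + σ) / 4 := by linarith

/-- The random logistic map is expanding near the origin, uniformly in the noise. -/
lemma exists_expansion_near_zero (hσ : 0 < σ) (h1 : 1 < a - σ) (h4 : a + σ < 4) :
    ∃ ε c : ℝ, 0 < ε ∧ ε ≤ (a + σ) / 4 ∧ 1 < c ∧ ∀ x : ℝ, 0 < x → x ≤ (a + σ) / 4 →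
      ∀ ω ∈ Icc (-1 : ℝ) 1, min (c * x) ε ≤ randomLogisticMap σ a x ω := by
  set b := a - σ with hb
  set C := (a + σ) / 4 with hC
  have hC0 : 0 < C := by linarith
  have hC1 : C < 1 := by linarith
  have hbC : 0 < b * (C * (1 - C)) := mul_pos (by linarith) (mul_pos hC0 (by linarith))
  set ε := min ((b - 1) / (2 * b)) (min (b * (C * (1 - C))) C) with hε
  have hε0 : 0 < ε := lt_min (div_pos (by linarith) (by linarith)) (lt_min hbC hC0)
  have hε1 : ε ≤ (b - 1) / (2 * b) := min_le_left _ _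
  have hε2 : ε ≤ b * (C * (1 - C)) := (min_le_right _ _).trans (min_le_left _ _)
  have hε3 : ε ≤ C := (min_le_right _ _).trans (min_le_right _ _)
  have hbε : (b + 1) / 2 ≤ b * (1 - ε) := by
    rw [le_div_iff₀ (by linarith)] at hε1
    linarith
  refine ⟨ε, (b + 1) / 2, hε0, hε3, by linarith, fun x hx0 hxC ω hω => ?_⟩
  have hgx : 0 ≤ x * (1 - x) := mul_nonneg hx0.le (by linarith)
  have hf : b * (x * (1 - x)) ≤ randomLogisticMap σ a x ω := by
    have : b ≤ a + σ * ω := by nlinarith [hω.1]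
    calc b * (x * (1 - x)) ≤ (a + σ * ω) * (x * (1 - x)) := mul_le_mul_of_nonneg_right this hgx
      _ = randomLogisticMap σ a x ω := by unfold randomLogisticMap; ring
  refine le_trans ?_ hf
  rcases le_total x ε with hx | hx
  · refine (min_le_left _ _).trans ?_
    calc (b + 1) / 2 * x ≤ b * (1 - ε) * x := mul_le_mul_of_nonneg_right hbε hx0.le
      _ ≤ b * (1 - x) * x := by
        refine mul_le_mul_of_nonneg_right (mul_le_mul_of_nonneg_left ?_ ?_) hx0.le <;> linarith
      _ = b * (x * (1 - x)) := by ring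
  · refine (min_le_right _ _).trans ?_
    rcases le_total (x + ε) 1 with h | h
    · have h₁ : ε * (1 - ε) ≤ x * (1 - x) := by
        nlinarith [mul_nonneg (sub_nonneg.2 hx) (sub_nonneg.2 h)]
      have h₂ := mul_le_mul_of_nonneg_left h₁ (by linarith : 0 ≤ b)
      nlinarith
    · have h₁ : C * (1 - C) ≤ x * (1 - x) := by
        nlinarith [mul_nonneg (sub_nonneg.2 hxC) (by linarith : 0 ≤ x + C - 1)]
      exact hε2.trans (mul_le_mul_of_nonneg_left h₁ (by linarith))

/-- There is an invariant compact subinterval of `(0, 1)` carrying every finite invariant measure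
concentrated on `(0, 1)`. -/
lemma exists_absorbing_Icc (hσ : 0 < σ) (h1 : 1 < a - σ) (h4 : a + σ < 4) :
    ∃ ε : ℝ, 0 < ε ∧ ε ≤ (a + σ) / 4 ∧
      (∀ x ∈ Icc ε ((a + σ) / 4), randomLogisticKernel σ a x (Icc ε ((a + σ) / 4))ᶜ = 0) ∧
      ∀ μ : Measure ℝ, IsFiniteMeasure μ → μ (Ioo 0 1)ᶜ = 0 →
        (randomLogisticKernel σ a).Invariant μ → μ (Icc ε ((a + σ) / 4))ᶜ = 0 := by
  obtain ⟨ε, c, hε, hεC, hc, hexp⟩ := exists_expansion_near_zero hσ h1 h4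
  refine ⟨ε, hε, hεC, fun x hx => ?_, fun μ _ hμ01 hμ => ?_⟩
  · refine randomLogisticKernel_eq_zero measurableSet_Icc.compl fun ω hω hn => hn ⟨?_, ?_⟩
    · refine le_trans (le_min ?_ le_rfl) (hexp x (hε.trans_le hx.1) hx.2 ω hω)
      nlinarith [hx.1]
    · exact randomLogisticMap_le hσ h1 hω
  have hinv : ∀ A : Set ℝ, MeasurableSet A → μ A = ∫⁻ x, randomLogisticKernel σ a x A ∂μ := by
    intro A hA
    conv_lhs => rw [← hμ.def]
    exact Measure.bind_apply hA (Kernel.aemeasurable _)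
  have hhigh : μ (Ioi ((a + σ) / 4)) = 0 := by
    rw [hinv _ measurableSet_Ioi]
    simp only [randomLogisticKernel_eq_zero measurableSet_Ioi fun ω hω h =>
      not_lt.2 (randomLogisticMap_le hσ h1 hω) h, lintegral_zero]
  have hae : ∀ᵐ x ∂μ, 0 < x ∧ x ≤ (a + σ) / 4 := by
    filter_upwards [compl_mem_ae_iff.2 hμ01, compl_mem_ae_iff.2 hhigh] with x hx hx'
    exact ⟨(not_not.1 hx).1, not_lt.1 hx'⟩
  have hstep : ∀ n : ℕ, μ (Iio (ε / c ^ n)) ≤ μ (Iio (ε / c ^ (n + 1))) := by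
    intro n
    rw [hinv _ measurableSet_Iio, ← lintegral_indicator_one measurableSet_Iio]
    refine lintegral_mono_ae ?_
    filter_upwards [hae] with x hx
    by_cases hxm : x ∈ Iio (ε / c ^ (n + 1))
    · rw [indicator_of_mem hxm]
      exact prob_le_one
    · rw [indicator_of_notMem hxm]
      refine (randomLogisticKernel_eq_zero measurableSet_Iio fun ω hω h => ?_).le
      refine not_lt.2 (le_trans (le_min ?_ ?_) (hexp x hx.1 hx.2 ω hω)) h
      · have : ε / c ^ (n + 1) ≤ x := not_lt.1 hxm
        rw [div_le_iff₀ (by positivity), pow_succ] at this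
        rw [div_le_iff₀ (by positivity)]
        linarith
      · exact div_le_self hε.le (one_le_pow₀ hc.le)
  have hle : ∀ n : ℕ, μ (Iio ε) ≤ μ (Iio (ε / c ^ n)) := by
    intro n
    induction n with
    | zero => simp
    | succ n ih => exact ih.trans (hstep n)
  have hto : Tendsto (fun n : ℕ => ε / c ^ n) atTop (𝓝 0) :=
    tendsto_const_nhds.div_atTop (tendsto_pow_atTop_atTop_of_one_lt hc)
  have hlow : μ (Iio ε) = 0 := by
    have hlim := tendsto_measure_iInter_atTop (μ := μ) (s := fun n : ℕ => Iio (ε / c ^ n))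
      (fun n => measurableSet_Iio.nullMeasurableSet)
      (fun m n hmn => Iio_subset_Iio
        (div_le_div_of_nonneg_left hε.le (by positivity) (pow_le_pow_right₀ hc.le hmn)))
      ⟨0, measure_ne_top _ _⟩
    have hnull : μ (⋂ n : ℕ, Iio (ε / c ^ n)) = 0 := by
      refine measure_mono_null (t := (Ioo 0 1)ᶜ) (fun x hx h01 => ?_) hμ01
      have hx0 : x ≤ 0 := ge_of_tendsto' hto fun n => (mem_iInter.1 hx n).le
      exact not_lt.2 hx0 h01.1
    rw [hnull] at hlim
    exact le_antisymm (ge_of_tendsto' hlim hle) zero_le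
  refine measure_mono_null (fun x hx => ?_) (measure_union_null hlow hhigh)
  rw [mem_compl_iff, mem_Icc, not_and_or, not_le, not_le] at hx
  exact hx

lemma iterate_half_mem_Ioo (ha : 0 < a) (ha4 : a < 4) (n : ℕ) :
    (fun x : ℝ => a * (x * (1 - x)))^[n] (1 / 2) ∈ Ioo (0 : ℝ) 1 := by
  induction n with
  | zero => norm_num
  | succ n ih =>
    rw [Function.iterate_succ_apply']
    generalize (fun x : ℝ => a * (x * (1 - x)))^[n] (1 / 2) = y at ih
    have hg : 0 < y * (1 - y) := mul_pos ih.1 (by linarith [ih.2])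
    exact ⟨mul_pos ha hg, by nlinarith [sq_nonneg (y - 1 / 2)]⟩

/-- The noiseless critical orbit eventually enters the support of every invariant measure. -/
lemma exists_iterate_half_mem_support (hσ : 0 < σ) (h1 : 1 < a - σ) (h4 : a + σ < 4)
    {μ : Measure ℝ} [IsFiniteMeasure μ] (hμ0 : μ ≠ 0) (hμ01 : μ (Ioo 0 1)ᶜ = 0)
    (hμ : (randomLogisticKernel σ a).Invariant μ) :
    ∃ n : ℕ, ∀ k ≥ n, (fun x : ℝ => a * (x * (1 - x)))^[k] (1 / 2) ∈ μ.support := by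
  set f : ℝ → ℝ := fun x => a * (x * (1 - x)) with hf
  have hfc : Continuous f := by fun_prop
  obtain ⟨ε, hε, -, -, habs⟩ := exists_absorbing_Icc hσ h1 h4
  have hsub : μ.support ⊆ Ioo 0 1 :=
    (Measure.support_subset_of_isClosed isClosed_Icc
      (mem_ae_iff.2 (habs μ inferInstance hμ01 hμ))).trans
      fun x hx => ⟨hε.trans_le hx.1, by linarith [hx.2]⟩
  have hIcc : ∀ y ∈ μ.support,
      Icc ((a - σ) * (y * (1 - y))) ((a + σ) * (y * (1 - y))) ⊆ μ.support := by
    intro y hy w hw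
    obtain ⟨ω, hω, rfl⟩ := exists_randomLogisticMap_eq (hsub hy) hw
    exact randomLogisticMap_mem_support hμ hy hω
  have hlt : ∀ y ∈ μ.support, (a - σ) * (y * (1 - y)) < f y ∧ f y < (a + σ) * (y * (1 - y)) := by
    intro y hy
    have hg : 0 < y * (1 - y) := mul_pos (hsub hy).1 (by linarith [(hsub hy).2])
    have := mul_pos hσ hg
    constructor <;> simp only [hf] <;> linarith
  have hfM : ∀ y ∈ μ.support, f y ∈ μ.support := fun y hy =>
    hIcc y hy ⟨(hlt y hy).1.le, (hlt y hy).2.le⟩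
  set O : Set ℝ := range fun n : ℕ => f^[n] (1 / 2) with hO
  have hO01 : closure O ⊆ Icc 0 1 := by
    refine closure_minimal ?_ isClosed_Icc
    rintro _ ⟨n, rfl⟩
    exact Ioo_subset_Icc_self (iterate_half_mem_Ioo (by linarith) (by linarith) n)
  have hOf : MapsTo f (closure O) (closure O) := by
    refine MapsTo.closure ?_ hfc
    rintro _ ⟨n, rfl⟩
    exact ⟨n + 1, Function.iterate_succ_apply' _ _ _⟩
  obtain ⟨y, hy, hyO⟩ : ∃ y ∈ μ.support, y ∈ closure O := by
    by_contra! hcon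
    obtain ⟨y, hy⟩ := Measure.nonempty_support hμ0
    refine not_Icc_subset_of_disjoint_invariant (l := a) (by linarith)
      (Measure.isClosed_support (μ := μ))
      (isClosed_closure.union (toFinite ({0, 1} : Set ℝ)).isClosed : IsClosed (closure O ∪ {0, 1}))
      (hsub.trans Ioo_subset_Icc_self) ?_ hfM ?_ ?_ ?_ ?_ ?_
      ((hlt y hy).1.trans (hlt y hy).2) (hIcc y hy)
    · refine union_subset hO01 ?_
      rintro x (rfl | rfl) <;> norm_num
    · rintro x (hx | rfl | rfl)
      · exact Or.inl (hOf hx)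
      · simp
      · simp
    · simp
    · exact Or.inl (subset_closure ⟨0, rfl⟩)
    · simp
    · refine disjoint_left.2 ?_
      rintro x hx (hx' | rfl | rfl)
      · exact hcon x hx hx'
      · exact lt_irrefl _ (hsub hx).1
      · exact lt_irrefl _ (hsub hx).2
  have hnhds : f ⁻¹' Ioo ((a - σ) * (y * (1 - y))) ((a + σ) * (y * (1 - y))) ∈ 𝓝 y :=
    hfc.continuousAt.preimage_mem_nhds (isOpen_Ioo.mem_nhds (hlt y hy))
  obtain ⟨_, hx, n, rfl⟩ := mem_closure_iff_nhds.1 hyO _ hnhds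
  refine ⟨n + 1, fun k hk => ?_⟩
  induction k, hk using Nat.le_induction with
  | base =>
    rw [Function.iterate_succ_apply']
    exact hIcc y hy (Ioo_subset_Icc_self hx)
  | succ k _ ih =>
    rw [Function.iterate_succ_apply']
    exact hfM _ ih

lemma randomLogisticKernel_invariant_unique (hσ : 0 < σ) (h1 : 1 < a - σ) (h4 : a + σ < 4)
    {μ ν : Measure ℝ} [IsProbabilityMeasure μ] [IsProbabilityMeasure ν]
    (hμ01 : μ (Ioo 0 1)ᶜ = 0) (hν01 : ν (Ioo 0 1)ᶜ = 0)
    (hμ : (randomLogisticKernel σ a).Invariant μ) (hν : (randomLogisticKernel σ a).Invariant ν) :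
    μ = ν := by
  refine hμ.eq_of_exists_common_lower_bound hν fun μ' ν' hle hle' hμ' hν' h0 h0' => ?_
  have := isFiniteMeasure_of_le μ hle
  have := isFiniteMeasure_of_le ν hle'
  obtain ⟨m, hm⟩ := exists_iterate_half_mem_support hσ h1 h4 h0
    (Measure.absolutelyContinuous_of_le hle hμ01) hμ'
  obtain ⟨n, hn⟩ := exists_iterate_half_mem_support hσ h1 h4 h0'
    (Measure.absolutelyContinuous_of_le hle' hν01) hν'
  obtain ⟨r, hr, hball⟩ := exists_ball_smul_volume_le hσ
    (iterate_half_mem_Ioo (a := a) (by linarith) (by linarith) (max m n))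
  obtain ⟨c, hc, hcμ⟩ := hball μ' hμ' (hm _ (le_max_left _ _))
  obtain ⟨d, hd, hdν⟩ := hball ν' hν' (hn _ (le_max_right _ _))
  generalize a * _ = z at hcμ hdν
  refine ⟨min c d • volume.restrict (Metric.ball z r), fun h => ?_, ?_, ?_⟩
  · have := congrArg (fun ρ : Measure ℝ => ρ univ) h
    simp only [Measure.smul_apply, Measure.restrict_apply .univ, univ_inter, smul_eq_mul,
      Measure.coe_zero, Pi.zero_apply, mul_eq_zero] at this
    rcases this with h | h
    · rcases min_choice c d with h' | h' <;> rw [h'] at h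
      · exact hc h
      · exact hd h
    · exact (Metric.measure_ball_pos volume z hr).ne' h
  · exact le_trans (Measure.le_iff.2 fun A _ => mul_le_mul_left (min_le_left c d) _) hcμ
  · exact le_trans (Measure.le_iff.2 fun A _ => mul_le_mul_left (min_le_right c d) _) hdν

end Logistic

end Auxiliary

/-- Fix `σ > 0` and `a ∈ ℝ` with `1 < a − σ` and
`a + σ < 4`, and consider the random logistic map
`f(x; ω) = (a + σω) x (1 − x)` on `[0, 1]` with noise `ω` drawn uniformly from
`[−1, 1]`.  Then there is exactly one stationary Borel probability measure `μ`
concentrated on `(0, 1)`: a unique `μ` with `μ((0, 1)) = 1` and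
`μ(A) = ∫ P(x, A) dμ(x)` for every Borel set `A`, where
`P(x, A) = ν{ω ∈ [−1, 1] : f(x; ω) ∈ A}`. -/
theorem random_logistic_map_unique_stationary_measure
    (σ a : ℝ) (hσ : 0 < σ) (h1 : 1 < a - σ) (h4 : a + σ < 4) :
    ∃! μ : Measure ℝ, IsProbabilityMeasure μ ∧ μ (Set.Ioo 0 1) = 1 ∧
      ∀ A : Set ℝ, MeasurableSet A →
        μ A = ∫⁻ x, uniformNoise {ω | randomLogisticMap σ a x ω ∈ A} ∂μ := by
  have hcompl : ∀ μ : Measure ℝ, IsProbabilityMeasure μ →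
      (μ (Set.Ioo 0 1) = 1 ↔ μ (Set.Ioo 0 1)ᶜ = 0) := fun μ _ =>
    (prob_compl_eq_zero_iff measurableSet_Ioo).symm
  obtain ⟨ε, hε, hεC, hK, -⟩ := exists_absorbing_Icc hσ h1 h4
  obtain ⟨μ, hμp, hμK, hμ⟩ := (randomLogisticKernel σ a).exists_invariant_of_isCompact
    continuous_lintegral_randomLogisticKernel isCompact_Icc ⟨ε, le_rfl, hεC⟩ hK
  have hμ01 : μ (Set.Ioo 0 1)ᶜ = 0 := by
    refine measure_mono_null (Set.compl_subset_compl.2 fun x hx => ?_) hμK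
    exact ⟨hε.trans_le hx.1, by linarith [hx.2]⟩
  refine ⟨μ, ⟨hμp, (hcompl μ hμp).2 hμ01, randomLogisticKernel_invariant_iff.1 hμ⟩, ?_⟩
  rintro ν ⟨hνp, hν01, hν⟩
  exact randomLogisticKernel_invariant_unique hσ h1 h4 ((hcompl ν hνp).1 hν01) hμ01
    (randomLogisticKernel_invariant_iff.2 hν) hμ
end

section
/- Fix ε ∈ (0, 1), σ > 0 and a ∈ ℝ. Let ν be the uniform probability measure on [−1, 1], ν^∞ the product measure on [−1, 1]^ℕ, and let μ be a stationary probability measure on ℝ/ℤ for the random standard circle map f_a. Suppose the product measure μ ⊗ ν^∞ is an ergodic invariant measure for the skew product S(x, ω) = (f_a(x; ω₁), ϑω) on (ℝ/ℤ) × [−1, 1]^ℕ, where ϑ is the left shift. Then for ν^∞-almost every noise sequence ω and every x ∈ ℝ, the rotation number exists and is given by ρ_a = lim_{k→∞} (F_a^k(x; ω) − x)/k = ∫_{ℝ/ℤ} ∫_{[−1,1]} ( a + σω' + (ε/(2π)) sin(2πs) ) dν(ω') dμ(s); in particular the rotation number is ν^∞-almost surely constant and independent of the initial point. -/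
open MeasureTheory Filter Real

/-- The lift of the random standard circle map:
`F_a(x; ω) = x + a + σω + (ε/(2π)) sin(2πx)`. -/
noncomputable def stdLift (ε σ a : ℝ) (ω x : ℝ) : ℝ :=
  x + a + σ * ω + (ε / (2 * π)) * Real.sin (2 * π * x)

/-- Iterates of the lift along a noise sequence `ω = (ω₁, ω₂, …)` (indexed
from `0`): `F_a^0(x; ω) = x` and `F_a^{k+1}(x; ω) = F_a(F_a^k(x; ω); ω_{k+1})`. -/
noncomputable def stdLiftIter (ε σ a : ℝ) (ω : ℕ → ℝ) : ℕ → ℝ → ℝ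
  | 0, x => x
  | k + 1, x => stdLift ε σ a (ω k) (stdLiftIter ε σ a ω k x)

/-- The random standard circle map induced on the circle `ℝ/ℤ`; the sine term
is evaluated at the representative of `x` in `[0, 1)`, which is well defined
since `sin(2π·)` has period 1. -/
noncomputable def randomStdCircleMap (ε σ a : ℝ) (x : UnitAddCircle) (ω : ℝ) :
    UnitAddCircle :=
  x + (↑(a + σ * ω + (ε / (2 * π)) *
    Real.sin (2 * π * ((AddCircle.equivIco 1 0 x : ℝ)))) : UnitAddCircle)

/-- The displacement function `δ_a(s, ω') = a + σω' + (ε/(2π)) sin(2πs)` of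
the random standard circle map, evaluated via the representative of
`s ∈ ℝ/ℤ` in `[0, 1)`. -/
noncomputable def displacement (ε σ a : ℝ) (s : UnitAddCircle) (ω' : ℝ) : ℝ :=
  a + σ * ω' + (ε / (2 * π)) *
    Real.sin (2 * π * ((AddCircle.equivIco 1 0 s : ℝ)))

section PointwiseErgodic

variable {α : Type*}

/-- The running maximum `max (0, S₁ g, …, Sₙ g)` of the Birkhoff sums of `g`. -/
noncomputable def birkhoffMax (T : α → α) (g : α → ℝ) : ℕ → α → ℝ
  | 0, _ => 0
  | n + 1, x => max 0 (g x + birkhoffMax T g n (T x))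

theorem birkhoffMax_nonneg (T : α → α) (g : α → ℝ) (n : ℕ) (x : α) :
    0 ≤ birkhoffMax T g n x := by
  cases n
  · exact le_rfl
  · exact le_max_left _ _

theorem birkhoffMax_le_succ (T : α → α) (g : α → ℝ) (n : ℕ) (x : α) :
    birkhoffMax T g n x ≤ birkhoffMax T g (n + 1) x := by
  induction n generalizing x with
  | zero => exact birkhoffMax_nonneg T g 1 x
  | succ n ih => exact max_le_max le_rfl (by linarith [ih (T x)])

theorem birkhoffSum_le_birkhoffMax (T : α → α) (g : α → ℝ) (n : ℕ) (x : α) :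
    birkhoffSum T g n x ≤ birkhoffMax T g n x := by
  induction n generalizing x with
  | zero => simp [birkhoffMax]
  | succ n ih =>
    rw [birkhoffSum_succ']
    exact le_max_of_le_right (by linarith [ih (T x)])

theorem birkhoffMax_succ_sub (T : α → α) (g : α → ℝ) (n : ℕ) (x : α) :
    birkhoffMax T g (n + 1) x - birkhoffMax T g n (T x) =
      max (-birkhoffMax T g n (T x)) (g x) := by
  rw [birkhoffMax, sub_eq_add_neg, ← max_add_add_right, zero_add, add_neg_cancel_right]

theorem bddAbove_range_birkhoffSum_apply_iff (T : α → α) (g : α → ℝ) (x : α) :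
    BddAbove (Set.range fun n => birkhoffSum T g n (T x)) ↔
      BddAbove (Set.range fun n => birkhoffSum T g n x) := by
  simp only [bddAbove_def, Set.forall_mem_range]
  constructor
  · rintro ⟨C, hC⟩
    refine ⟨max 0 (g x + C), fun n => ?_⟩
    cases n with
    | zero => simp
    | succ n =>
      rw [birkhoffSum_succ']
      exact le_max_of_le_right (by linarith [hC n])
  · rintro ⟨C, hC⟩
    refine ⟨C - g x, fun n => ?_⟩
    have := hC (n + 1)
    rw [birkhoffSum_succ'] at this
    linarith

variable [MeasurableSpace α] {m : Measure α} {T : α → α} {g : α → ℝ}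

theorem integrable_birkhoffMax (hT : MeasurePreserving T m m) (hg : Integrable g m) (n : ℕ) :
    Integrable (birkhoffMax T g n) m := by
  induction n with
  | zero => exact integrable_zero _ _ _
  | succ n ih =>
    exact (integrable_zero α ℝ m).sup (hg.add (hT.integrable_comp_of_integrable ih))

theorem measurable_birkhoffSum (hT : Measurable T) (hg : Measurable g) (n : ℕ) :
    Measurable (birkhoffSum T g n) :=
  Finset.measurable_sum _ fun k _ => hg.comp (hT.iterate k)

/-- Birkhoff sums of a function with negative mean over an ergodic map are almost everywhere
bounded above. -/
theorem Ergodic.ae_bddAbove_birkhoffSum (hT : Ergodic T m) (hg : Measurable g)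
    (hgi : Integrable g m) (hneg : ∫ x, g x ∂m < 0) :
    ∀ᵐ x ∂m, BddAbove (Set.range fun n => birkhoffSum T g n x) := by
  have hmeas : MeasurableSet {x | BddAbove (Set.range fun n => birkhoffSum T g n x)} :=
    measurableSet_bddAbove_range fun n => measurable_birkhoffSum hT.measurable hg n
  refine (hT.toPreErgodic.ae_mem_or_ae_notMem hmeas
    (Set.ext fun x => bddAbove_range_birkhoffSum_apply_iff T g x)).resolve_right fun hunb => ?_
  have hMi := integrable_birkhoffMax hT.toMeasurePreserving hgi
  have hMTi (n : ℕ) : Integrable (fun x => birkhoffMax T g n (T x)) m :=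
    hT.toMeasurePreserving.integrable_comp_of_integrable (hMi n)
  have hnonneg (n : ℕ) :
      0 ≤ ∫ x, (birkhoffMax T g (n + 1) x - birkhoffMax T g n (T x)) ∂m := by
    have hcomp : ∫ x, birkhoffMax T g n (T x) ∂m = ∫ x, birkhoffMax T g n x ∂m := by
      rw [← integral_map hT.measurable.aemeasurable, hT.map_eq]
      rw [hT.map_eq]
      exact (hMi n).aestronglyMeasurable
    rw [integral_sub (hMi _) (hMTi n), hcomp, sub_nonneg]
    exact integral_mono (hMi _) (hMi _) fun x => birkhoffMax_le_succ T g n x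
  have hlim : Tendsto
      (fun n : ℕ => ∫ x, (birkhoffMax T g (n + 1) x - birkhoffMax T g n (T x)) ∂m)
      atTop (nhds (∫ x, g x ∂m)) := by
    refine tendsto_integral_of_dominated_convergence (fun x => |g x|)
      (fun n => ((hMi _).sub (hMTi n)).aestronglyMeasurable) hgi.abs
      (fun n => ae_of_all _ fun x => ?_) ?_
    · rw [birkhoffMax_succ_sub, Real.norm_eq_abs, abs_le]
      exact ⟨(neg_abs_le _).trans (le_max_right _ _),
        max_le (by linarith [birkhoffMax_nonneg T g n (T x), abs_nonneg (g x)]) (le_abs_self _)⟩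
    · filter_upwards [hunb] with x hx
      have hx' : ¬ BddAbove (Set.range fun n => birkhoffSum T g n (T x)) := fun h =>
        hx ((bddAbove_range_birkhoffSum_apply_iff T g x).1 h)
      obtain ⟨_, ⟨N, rfl⟩, hN⟩ := not_bddAbove_iff.1 hx' (-g x)
      refine tendsto_const_nhds.congr' ?_
      filter_upwards [eventually_ge_atTop N] with n hn
      have hmono := monotone_nat_of_le_succ (fun k => birkhoffMax_le_succ T g k (T x)) hn
      have := birkhoffSum_le_birkhoffMax T g N (T x)
      rw [birkhoffMax_succ_sub, max_eq_right]
      linarith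
  exact absurd (ge_of_tendsto' hlim hnonneg) (not_le.2 hneg)

theorem Ergodic.ae_forall_eventually_birkhoffSum_div_lt [IsProbabilityMeasure m]
    (hT : Ergodic T m) (hg : Measurable g) (hgi : Integrable g m) :
    ∀ᵐ x ∂m, ∀ c > ∫ x, g x ∂m, ∀ᶠ n : ℕ in atTop, birkhoffSum T g n x / n < c := by
  have hbdd (k : ℕ) : ∀ᵐ x ∂m, BddAbove (Set.range fun n =>
      birkhoffSum T (fun y => g y - (∫ x, g x ∂m + 1 / ((k : ℝ) + 1))) n x) := by
    refine hT.ae_bddAbove_birkhoffSum (hg.sub_const _) (hgi.sub (integrable_const _)) ?_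
    rw [integral_sub hgi (integrable_const _)]
    simp only [integral_const, probReal_univ, smul_eq_mul, one_mul]
    have : 0 < 1 / ((k : ℝ) + 1) := by positivity
    linarith
  filter_upwards [ae_all_iff.2 hbdd] with x hx c hc
  obtain ⟨k, hk⟩ := exists_nat_one_div_lt (sub_pos.2 hc)
  obtain ⟨C, hC⟩ := hx k
  set d : ℝ := ∫ x, g x ∂m + 1 / ((k : ℝ) + 1) with hd
  have hlim : Tendsto (fun n : ℕ => d + C / n) atTop (nhds d) := by
    simpa using tendsto_const_nhds.add (tendsto_const_div_atTop_nhds_zero_nat C)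
  filter_upwards [hlim.eventually_lt_const (show d < c by linarith), eventually_gt_atTop 0]
    with n hn hn0
  refine lt_of_le_of_lt ?_ hn
  have hn0' : (0 : ℝ) < n := by exact_mod_cast hn0
  have hsum := hC ⟨n, rfl⟩
  simp only [birkhoffSum, Finset.sum_sub_distrib, Finset.sum_const, Finset.card_range,
    nsmul_eq_mul] at hsum ⊢
  rw [div_le_iff₀ hn0', add_mul, div_mul_cancel₀ _ hn0'.ne']
  linarith

/-- The pointwise ergodic theorem for an ergodic map of a probability space. -/
theorem Ergodic.ae_tendsto_birkhoffSum_div [IsProbabilityMeasure m]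
    (hT : Ergodic T m) (hg : Measurable g) (hgi : Integrable g m) :
    ∀ᵐ x ∂m, Tendsto (fun n : ℕ => birkhoffSum T g n x / n) atTop (nhds (∫ x, g x ∂m)) := by
  filter_upwards [hT.ae_forall_eventually_birkhoffSum_div_lt hg hgi,
    hT.ae_forall_eventually_birkhoffSum_div_lt hg.neg hgi.neg] with x hx hx'
  refine tendsto_order.2 ⟨fun c hc => ?_, hx⟩
  have hneg := hx' (-c) (by simp only [Pi.neg_apply, integral_neg]; linarith)
  filter_upwards [hneg] with n hn
  rw [show (-g : α → ℝ) = fun y => -g y from rfl] at hn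
  simp only [birkhoffSum, Finset.sum_neg_distrib, neg_div] at hn ⊢
  linarith

end PointwiseErgodic

section StdLift

theorem sin_equivIco_coe (x : ℝ) :
    Real.sin (2 * π * ((AddCircle.equivIco 1 0 (x : UnitAddCircle) : ℝ))) =
      Real.sin (2 * π * x) := by
  rw [AddCircle.coe_equivIco_mk_apply, div_one, mul_one, Int.fract,
    ← Real.sin_sub_int_mul_two_pi (2 * π * x) ⌊x⌋]
  congr 1
  ring

theorem displacement_coe (ε σ a x ω : ℝ) :
    displacement ε σ a (x : UnitAddCircle) ω = stdLift ε σ a ω x - x := by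
  rw [displacement, sin_equivIco_coe, stdLift]
  ring

theorem randomStdCircleMap_coe (ε σ a x ω : ℝ) :
    randomStdCircleMap ε σ a (x : UnitAddCircle) ω = (stdLift ε σ a ω x : UnitAddCircle) := by
  rw [randomStdCircleMap, sin_equivIco_coe, stdLift, ← AddCircle.coe_add]
  congr 1
  ring

theorem stdLift_add_int (ε σ a ω x : ℝ) (n : ℤ) :
    stdLift ε σ a ω (x + n) = stdLift ε σ a ω x + n := by
  have h : Real.sin (2 * π * (x + n)) = Real.sin (2 * π * x) := by
    rw [← Real.sin_add_int_mul_two_pi (2 * π * x) n]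
    congr 1
    ring
  rw [stdLift, stdLift, h]
  ring

theorem monotone_stdLift {ε : ℝ} (hε : ε ∈ Set.Ioo (0 : ℝ) 1) (σ a ω : ℝ) :
    Monotone (stdLift ε σ a ω) := by
  intro x y hxy
  have hsin : |Real.sin (2 * π * x) - Real.sin (2 * π * y)| ≤ 2 * π * (y - x) := by
    have := Real.abs_sin_sub_sin_le (2 * π * x) (2 * π * y)
    rwa [← mul_sub, abs_mul, abs_of_pos Real.two_pi_pos, abs_sub_comm x y,
      abs_of_nonneg (sub_nonneg.2 hxy)] at this
  have hmul : ε / (2 * π) * (Real.sin (2 * π * x) - Real.sin (2 * π * y)) ≤ y - x :=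
    calc _ ≤ ε / (2 * π) * (2 * π * (y - x)) :=
          mul_le_mul_of_nonneg_left ((le_abs_self _).trans hsin)
            (div_nonneg hε.1.le (by positivity))
      _ = ε * (y - x) := by field_simp
      _ ≤ y - x := mul_le_of_le_one_left (sub_nonneg.2 hxy) hε.2.le
  simp only [stdLift]
  linarith

theorem stdLiftIter_add_int (ε σ a : ℝ) (ω : ℕ → ℝ) (k : ℕ) (x : ℝ) (n : ℤ) :
    stdLiftIter ε σ a ω k (x + n) = stdLiftIter ε σ a ω k x + n := by
  induction k with
  | zero => rfl
  | succ k ih => rw [stdLiftIter, ih, stdLift_add_int, stdLiftIter]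

theorem monotone_stdLiftIter {ε : ℝ} (hε : ε ∈ Set.Ioo (0 : ℝ) 1) (σ a : ℝ) (ω : ℕ → ℝ)
    (k : ℕ) : Monotone (stdLiftIter ε σ a ω k) := by
  induction k with
  | zero => exact monotone_id
  | succ k ih => exact (monotone_stdLift hε σ a (ω k)).comp ih

theorem stdLiftIter_le_add_ceil {ε : ℝ} (hε : ε ∈ Set.Ioo (0 : ℝ) 1) (σ a : ℝ) (ω : ℕ → ℝ)
    (k : ℕ) (x y : ℝ) :
    stdLiftIter ε σ a ω k x ≤ stdLiftIter ε σ a ω k y + ⌈x - y⌉ := by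
  rw [← stdLiftIter_add_int]
  exact monotone_stdLiftIter hε σ a ω k (by linarith [Int.le_ceil (x - y)])

/-- The rotation number of a noise sequence does not depend on the initial point. -/
theorem tendsto_stdLiftIter_of_tendsto {ε : ℝ} (hε : ε ∈ Set.Ioo (0 : ℝ) 1) (σ a : ℝ)
    (ω : ℕ → ℝ) {y ρ : ℝ}
    (hy : Tendsto (fun k : ℕ => (stdLiftIter ε σ a ω k y - y) / k) atTop (nhds ρ)) (x : ℝ) :
    Tendsto (fun k : ℕ => (stdLiftIter ε σ a ω k x - x) / k) atTop (nhds ρ) := by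
  have hshift (C : ℝ) : Tendsto (fun k : ℕ => (stdLiftIter ε σ a ω k y - y) / k + C / k)
      atTop (nhds ρ) := by
    simpa using hy.add (tendsto_const_div_atTop_nhds_zero_nat C)
  refine tendsto_of_tendsto_of_tendsto_of_le_of_le (hshift (y - x - ⌈y - x⌉))
    (hshift (y - x + ⌈x - y⌉)) (fun k => ?_) (fun k => ?_)
  · simp only [← add_div]
    gcongr
    linarith [stdLiftIter_le_add_ceil hε σ a ω k y x]
  · simp only [← add_div]
    gcongr
    linarith [stdLiftIter_le_add_ceil hε σ a ω k x y]

/-- The skew product `(x, ω) ↦ (f_a(x; ω₁), ϑω)`. -/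
noncomputable def stdSkewProduct (ε σ a : ℝ) (p : UnitAddCircle × (ℕ → ℝ)) :
    UnitAddCircle × (ℕ → ℝ) :=
  (randomStdCircleMap ε σ a p.1 (p.2 0), fun n => p.2 (n + 1))

theorem stdSkewProduct_iterate (ε σ a x : ℝ) (ω : ℕ → ℝ) (k : ℕ) :
    (stdSkewProduct ε σ a)^[k] ((x : UnitAddCircle), ω) =
      ((stdLiftIter ε σ a ω k x : UnitAddCircle), fun n => ω (n + k)) := by
  induction k with
  | zero => rfl
  | succ k ih =>
    rw [Function.iterate_succ_apply', ih, stdSkewProduct, randomStdCircleMap_coe]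
    simp only [zero_add, stdLiftIter, add_assoc, add_comm 1 k]

theorem birkhoffSum_displacement (ε σ a x : ℝ) (ω : ℕ → ℝ) (k : ℕ) :
    birkhoffSum (stdSkewProduct ε σ a) (fun p => displacement ε σ a p.1 (p.2 0)) k
      ((x : UnitAddCircle), ω) = stdLiftIter ε σ a ω k x - x := by
  induction k with
  | zero => simp [stdLiftIter]
  | succ k ih =>
    rw [birkhoffSum_succ, ih, stdSkewProduct_iterate]
    simp only [displacement_coe, zero_add, stdLiftIter]
    ring

theorem measurable_displacement (ε σ a : ℝ) :
    Measurable fun p : UnitAddCircle × ℝ => displacement ε σ a p.1 p.2 := by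
  have h : Measurable fun s : UnitAddCircle => ((AddCircle.equivIco 1 0 s : ℝ)) :=
    measurable_subtype_coe.comp (AddCircle.measurableEquivIco 1 0).measurable
  unfold displacement
  fun_prop

instance inst_s16 : IsProbabilityMeasure uniformNoise := by
  constructor
  simp only [uniformNoise, Measure.smul_apply, Measure.restrict_apply_univ, Real.volume_Icc,
    smul_eq_mul]
  norm_num
  exact ENNReal.inv_mul_cancel two_ne_zero ENNReal.ofNat_ne_top

theorem ae_uniformNoise_abs_le_one : ∀ᵐ ω ∂uniformNoise, |ω| ≤ 1 := by
  refine Measure.ae_smul_measure ?_ _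
  filter_upwards [ae_restrict_mem measurableSet_Icc] with ω hω
  exact abs_le.2 hω

theorem integrable_displacement (ε σ a : ℝ) (μ : Measure UnitAddCircle)
    [IsProbabilityMeasure μ] :
    Integrable (fun p : UnitAddCircle × ℝ => displacement ε σ a p.1 p.2)
      (μ.prod uniformNoise) := by
  refine Integrable.of_bound (measurable_displacement ε σ a).aestronglyMeasurable
    (|a| + |σ| + |ε / (2 * π)|) ?_
  filter_upwards [Measure.quasiMeasurePreserving_snd.ae ae_uniformNoise_abs_le_one] with p hp
  refine (abs_add_three _ _ _).trans ?_
  rw [abs_mul, abs_mul]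
  gcongr
  · exact mul_le_of_le_one_right (abs_nonneg _) hp
  · exact mul_le_of_le_one_right (abs_nonneg _) (Real.abs_sin_le_one _)

/-- The first coordinate of the noise sequence is uniformly distributed. -/
theorem measurePreserving_eval_zero {νseq : Measure (ℕ → ℝ)} [IsProbabilityMeasure νseq]
    (hνseq : Measure.map (fun ω : ℕ → ℝ => (ω 0, fun n => ω (n + 1))) νseq
      = uniformNoise.prod νseq) :
    MeasurePreserving (fun ω : ℕ → ℝ => ω 0) νseq uniformNoise := by
  have h : Measurable fun ω : ℕ → ℝ => (ω 0, fun n => ω (n + 1)) := by fun_prop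
  exact measurePreserving_fst.comp (⟨h, hνseq⟩ : MeasurePreserving _ νseq (uniformNoise.prod νseq))

end StdLift

/-- Fix `ε ∈ (0, 1)`, `σ > 0`, `a ∈ ℝ`.  Let `ν` be the
uniform probability measure on `[−1, 1]`, `νseq` the infinite product of
copies of `ν` on `[−1, 1]^ℕ` (characterized by the fact that the first
coordinate together with the shifted tail has distribution `ν ⊗ νseq`), and
let `μ` be a stationary probability measure on `ℝ/ℤ` for the random standard
circle map `f_a`.  If `μ ⊗ νseq` is ergodic for the skew product
`S(x, ω) = (f_a(x; ω₁), ϑω)`, then for `νseq`-almost every noise sequence `ω`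
and every `x ∈ ℝ` the rotation number exists and equals
`∫∫ (a + σω' + (ε/(2π)) sin(2πs)) dν(ω') dμ(s)`; in particular it is almost
surely constant and independent of the initial point. -/
theorem random_rotation_number_ergodic_formula
    (ε σ a : ℝ) (hε : ε ∈ Set.Ioo (0 : ℝ) 1) (hσ : 0 < σ)
    (νseq : Measure (ℕ → ℝ)) [IsProbabilityMeasure νseq]
    (hνseq : Measure.map (fun ω : ℕ → ℝ => (ω 0, fun n => ω (n + 1))) νseq
      = uniformNoise.prod νseq)
    (μ : Measure UnitAddCircle) [IsProbabilityMeasure μ]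
    (hstat : ∀ A : Set UnitAddCircle, MeasurableSet A →
        μ A = ∫⁻ x, uniformNoise {ω | randomStdCircleMap ε σ a x ω ∈ A} ∂μ)
    (herg : Ergodic
      (fun p : UnitAddCircle × (ℕ → ℝ) =>
        (randomStdCircleMap ε σ a p.1 (p.2 0), fun n => p.2 (n + 1)))
      (μ.prod νseq)) :
    ∀ᵐ ω ∂νseq, ∀ x : ℝ,
      Tendsto (fun k : ℕ => (stdLiftIter ε σ a ω k x - x) / k) atTop
        (nhds (∫ s, ∫ ω', displacement ε σ a s ω' ∂uniformNoise ∂μ)) := by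
  have hmp : MeasurePreserving (Prod.map id fun ω : ℕ → ℝ => ω 0) (μ.prod νseq)
      (μ.prod uniformNoise) :=
    (MeasurePreserving.id μ).prod (measurePreserving_eval_zero hνseq)
  have hmeas := measurable_displacement ε σ a
  have hint := integrable_displacement ε σ a μ
  have hmean : ∫ p : UnitAddCircle × (ℕ → ℝ), displacement ε σ a p.1 (p.2 0) ∂(μ.prod νseq) =
      ∫ s, ∫ ω', displacement ε σ a s ω' ∂uniformNoise ∂μ := by
    rw [← integral_prod _ hint, ← hmp.map_eq,
      integral_map hmp.measurable.aemeasurable hmeas.aestronglyMeasurable]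
    rfl
  have hbirk := Ergodic.ae_tendsto_birkhoffSum_div (T := stdSkewProduct ε σ a) herg
    (g := fun p => displacement ε σ a p.1 (p.2 0)) (hmeas.comp hmp.measurable)
    (hmp.integrable_comp_of_integrable hint)
  rw [hmean] at hbirk
  have hswap := Measure.ae_ae_of_ae_prod
    ((Measure.measurePreserving_swap (μ := νseq) (ν := μ)).quasiMeasurePreserving.ae hbirk)
  filter_upwards [hswap] with ω hω x
  obtain ⟨s, hs⟩ := hω.exists
  obtain ⟨y, rfl⟩ := QuotientAddGroup.mk_surjective s
  refine tendsto_stdLiftIter_of_tendsto hε σ a ω (y := y) (hs.congr fun k => ?_) x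
  exact congrArg (· / (k : ℝ)) (birkhoffSum_displacement ε σ a y ω k)
end
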